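/- Let A be a bounded residuated lattice, n > 0, and b : A → A a function such that for every a ∈ A, b(a) is a Boolean element and aⁿ ≤ b(a). Then Rad(A) ⊆ {a ∈ A : b(a) = ⊤}, i.e., b(a) = ⊤ for every a ∈ Rad(A). -/

import Mathlib

universe u

/-- A bounded (integral, commutative) residuated lattice: a bounded lattice
with a commutative monoid operation `mul` (with unit `⊤`) and a residuum
`himp` satisfying the residuation condition. -/
class BRL (α : Type u) extends Lattice α, BoundedOrder α where
  mul : α → α → α
  himp : α → α → α
  mul_comm : ∀ a b : α, mul a b = mul b a
  mul_assoc : ∀ a b c : α, mul (mul a b) c = mul a (mul b c)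
  mul_top : ∀ a : α, mul a ⊤ = a
  residuation : ∀ a b c : α, mul a b ≤ c ↔ a ≤ himp b c

namespace BRL

variable {α : Type u} [BRL α]

/-- `¬a := a → ⊥`. -/
def neg (a : α) : α := himp a ⊥

/-- `a + b := ¬(¬a · ¬b)`. -/
def add (a b : α) : α := neg (mul (neg a) (neg b))

/-- Powers: `a⁰ = ⊤`, `aⁿ⁺¹ = a · aⁿ`. -/
def pow (a : α) : ℕ → α
  | 0 => ⊤
  | n + 1 => mul a (pow a n)

/-- Multiples: `0.a = ⊥`, `(n+1).a = a + n.a`. -/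
def nmul : ℕ → α → α
  | 0, _ => ⊥
  | n + 1, a => add a (nmul n a)

/-- Implicative filter. -/
def IsFilter (F : Set α) : Prop :=
  ⊤ ∈ F ∧ (∀ a b : α, a ∈ F → a ≤ b → b ∈ F) ∧
    (∀ a b : α, a ∈ F → b ∈ F → mul a b ∈ F)

/-- The smallest implicative filter containing `S`. -/
def genFilter (S : Set α) : Set α := ⋂₀ {F : Set α | IsFilter F ∧ S ⊆ F}

/-- Maximal (proper) implicative filter. -/
def IsMaximal (M : Set α) : Prop :=
  IsFilter M ∧ M ≠ Set.univ ∧ ∀ G : Set α, IsFilter G → M ⊂ G → G = Set.univ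

/-- Prime (proper) implicative filter. -/
def IsPrime (P : Set α) : Prop :=
  IsFilter P ∧ P ≠ Set.univ ∧ ∀ a b : α, a ⊔ b ∈ P → a ∈ P ∨ b ∈ P

/-- Minimal prime implicative filter (minimal among prime implicative filters). -/
def IsMinimalPrime (P : Set α) : Prop :=
  IsPrime P ∧ ∀ Q : Set α, IsPrime Q → Q ⊆ P → Q = P

/-- The radical: intersection of all maximal implicative filters. -/
def Rad : Set α := {a : α | ∀ M : Set α, IsMaximal M → a ∈ M}

/-- Boolean (complemented) element. -/
def Boolean (b : α) : Prop := b ⊔ neg b = ⊤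

/-- Stone ultrafilter: an implicative filter generated by an ultrafilter of
the Boolean algebra of Boolean elements. -/
def IsStoneUltra (F : Set α) : Prop :=
  IsFilter F ∧ F = genFilter (F ∩ {b : α | Boolean b}) ∧ (⊥ : α) ∉ F ∧
    ∀ b : α, Boolean b → b ∈ F ∨ neg b ∈ F

lemma mul_neg_le_bot (e : α) : mul e (neg e) ≤ ⊥ := by
  rw [mul_comm]
  exact (residuation _ _ _).2 le_rfl

lemma mul_le_mul' {a b c d : α} (hab : a ≤ b) (hcd : c ≤ d) : mul a c ≤ mul b d := by
  refine (residuation _ _ _).2 (hab.trans ((residuation _ _ _).1 ?_))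
  rw [mul_comm]
  refine (residuation _ _ _).2 (hcd.trans ((residuation _ _ _).1 ?_))
  rw [mul_comm]

/-- The complement of a Boolean element is idempotent (the nontrivial inequality). -/
lemma Boolean.neg_le_mul_self {e : α} (he : Boolean e) : neg e ≤ mul (neg e) (neg e) := by
  have h : (⊤ : α) ≤ himp (neg e) (mul (neg e) (neg e)) := by
    rw [← he]
    exact sup_le ((residuation _ _ _).1 ((mul_neg_le_bot e).trans bot_le))
      ((residuation _ _ _).1 le_rfl)
  have h' := (residuation _ _ _).2 h
  rwa [mul_comm, mul_top] at h'

lemma Boolean.isFilter_Ici_neg {e : α} (he : Boolean e) : IsFilter (Set.Ici (neg e)) :=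
  ⟨le_top, fun _ _ ha hab => le_trans ha hab,
    fun _ _ ha hb => he.neg_le_mul_self.trans (mul_le_mul' ha hb)⟩

lemma IsFilter.ne_univ_iff {F : Set α} (hF : IsFilter F) : F ≠ Set.univ ↔ ⊥ ∉ F := by
  refine not_congr ⟨fun h => h ▸ Set.mem_univ _, fun h => ?_⟩
  exact Set.eq_univ_of_forall fun x => hF.2.1 _ x h bot_le

lemma IsFilter.pow_mem {F : Set α} (hF : IsFilter F) {a : α} (ha : a ∈ F) (n : ℕ) :
    pow a n ∈ F := by
  induction n with
  | zero => exact hF.1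
  | succ n ih => exact hF.2.2 _ _ ha ih

lemma IsFilter.sUnion_of_isChain {c : Set (Set α)} (hc : ∀ F ∈ c, IsFilter F)
    (hchain : IsChain (· ⊆ ·) c) (hne : c.Nonempty) : IsFilter (⋃₀ c) := by
  obtain ⟨F, hF⟩ := hne
  refine ⟨⟨F, hF, (hc F hF).1⟩, ?_, ?_⟩
  · rintro a b ⟨G, hG, ha⟩ hab
    exact ⟨G, hG, (hc G hG).2.1 a b ha hab⟩
  · rintro a b ⟨G, hG, ha⟩ ⟨H, hH, hb⟩
    rcases hchain.total hG hH with h | h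
    · exact ⟨H, hH, (hc H hH).2.2 a b (h ha) hb⟩
    · exact ⟨G, hG, (hc G hG).2.2 a b ha (h hb)⟩

lemma IsFilter.exists_isMaximal_superset {F : Set α} (hF : IsFilter F) (hbot : ⊥ ∉ F) :
    ∃ M, F ⊆ M ∧ IsMaximal M := by
  obtain ⟨M, hFM, hM⟩ := zorn_subset_nonempty {G : Set α | IsFilter G ∧ ⊥ ∉ G}
    (fun c hc hchain hne => ⟨⋃₀ c,
      ⟨sUnion_of_isChain (fun G hG => (hc hG).1) hchain hne,
        fun ⟨G, hG, h⟩ => (hc hG).2 h⟩,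
      fun _ hG => Set.subset_sUnion_of_mem hG⟩) F ⟨hF, hbot⟩
  refine ⟨M, hFM, hM.prop.1, hM.prop.1.ne_univ_iff.2 hM.prop.2, fun G hG hMG => ?_⟩
  by_contra hne
  exact hMG.2 (hM.le_of_ge ⟨hG, hG.ne_univ_iff.1 hne⟩ hMG.1)

/-- A Boolean element that lies in every maximal filter is `⊤`. -/
lemma Boolean.eq_top_of_mem_rad {e : α} (he : Boolean e) (hrad : e ∈ (Rad : Set α)) :
    e = ⊤ := by
  by_cases h : neg e ≤ ⊥
  · have he' : e ⊔ neg e = ⊤ := he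
    rwa [sup_eq_left.2 (h.trans bot_le)] at he'
  · obtain ⟨M, hsub, hM⟩ := he.isFilter_Ici_neg.exists_isMaximal_superset h
    have hbot : mul e (neg e) ∈ M := hM.1.2.2 _ _ (hrad M hM) (hsub le_rfl)
    exact absurd (hM.1.2.1 _ _ hbot (mul_neg_le_bot e)) (hM.1.ne_univ_iff.1 hM.2.1)

theorem rad_subset_boolean_top (n : ℕ) (hn : 0 < n) (b : α → α)
    (hb : ∀ a : α, Boolean (b a) ∧ pow a n ≤ b a) :
    ∀ a : α, a ∈ (Rad : Set α) → b a = ⊤ := by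
  intro a ha
  obtain ⟨hbool, hle⟩ := hb a
  exact hbool.eq_top_of_mem_rad fun M hM => hM.1.2.1 _ _ (hM.1.pow_mem (ha M hM) n) hle

end BRL
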